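/- arXiv:2305.12056 — 4 statements merged into one kernel-verified Lean document; each statement's English description precedes it below -/
import Mathlib

section
/- Fix integers d, n, b with 1 ≤ b ≤ n, constants η > 0 and D > 0, and two datasets (a_1, y_1), …, (a_n, y_n) and (â_1, ŷ_1), …, (â_n, ŷ_n) of pairs in ℝ^d × ℝ that differ in at most one index, with ‖a_i‖ ≤ D, |y_i| ≤ D, ‖â_i‖ ≤ D, |ŷ_i| ≤ D for all i. Let Ω_1 be a uniformly distributed random subset of {1, …, n} of cardinality b, set H_1 = Σ_{i∈Ω_1} a_i a_iᵀ, q_1 = Σ_{i∈Ω_1} a_i y_i, Ĥ_1 = Σ_{i∈Ω_1} â_i â_iᵀ, q̂_1 = Σ_{i∈Ω_1} â_i ŷ_i, and for a fixed θ ∈ ℝ^d define θ_1 = (I − (η/b)H_1)θ + (η/b)q_1 and θ̂_1 = (I − (η/b)Ĥ_1)θ + (η/b)q̂_1. Then E‖θ_1 − θ̂_1‖ ≤ (2ηD²/n)(1 + ‖θ‖). -/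
open MeasureTheory ProbabilityTheory
open scoped InnerProductSpace ENNReal

theorem Finset.card_filter_mem_powersetCard_le {α : Type*} [DecidableEq α] (s : Finset α) (k : ℕ)
    {j : α} (hj : j ∈ s) :
    ((s.powersetCard (k + 1)).filter (fun t => j ∈ t)).card ≤ (s.card - 1).choose k := by
  have hsub : (s.powersetCard (k + 1)).filter (fun t => j ∈ t) ⊆
      ((s.erase j).powersetCard k).image (insert j) := by
    intro t ht
    obtain ⟨ht, hjt⟩ := Finset.mem_filter.mp ht
    obtain ⟨hts, hcard⟩ := Finset.mem_powersetCard.mp ht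
    refine Finset.mem_image.mpr ⟨t.erase j, ?_, Finset.insert_erase hjt⟩
    refine Finset.mem_powersetCard.mpr ⟨Finset.erase_subset_erase j hts, ?_⟩
    rw [Finset.card_erase_of_mem hjt, hcard, Nat.add_sub_cancel]
  calc _ ≤ _ := Finset.card_le_card hsub
    _ ≤ _ := Finset.card_image_le
    _ = _ := by rw [Finset.card_powersetCard, Finset.card_erase_of_mem hj]

theorem measurableSet_mem_of_measurableSet_eq {Ωs α : Type*} [MeasurableSpace Ωs] [Fintype α]
    {S : Ωs → Finset α} (hSmeas : ∀ s, MeasurableSet {ω | S ω = s}) (j : α) :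
    MeasurableSet {ω | j ∈ S ω} := by
  have h : {ω | j ∈ S ω} = ⋃ s ∈ {s : Finset α | j ∈ s}, {ω | S ω = s} := by
    ext ω
    simp
  rw [h]
  exact MeasurableSet.biUnion (Set.to_countable _) fun s _ => hSmeas s

/-- A uniformly distributed `b`-subset of `Fin n` contains a given index with probability at most
`b / n`. -/
theorem measureReal_mem_uniform_subset_le {Ωs : Type*} [MeasurableSpace Ωs] (P : Measure Ωs)
    [IsProbabilityMeasure P] {n b : ℕ} (hb : 1 ≤ b) (hbn : b ≤ n) {S : Ωs → Finset (Fin n)}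
    (hScard : ∀ ω, (S ω).card = b)
    (hSunif : ∀ s : Finset (Fin n), s.card = b →
      P {ω | S ω = s} = 1 / (n.choose b : ℝ≥0∞)) (j : Fin n) :
    P.real {ω | j ∈ S ω} ≤ (b : ℝ) / n := by
  obtain ⟨k, rfl⟩ : ∃ k, b = k + 1 := ⟨b - 1, by omega⟩
  obtain ⟨m, rfl⟩ : ∃ m, n = m + 1 := ⟨n - 1, by omega⟩
  set T := ((Finset.univ : Finset (Fin (m + 1))).powersetCard (k + 1)).filter (fun t => j ∈ t)
    with hT
  have hsub : {ω | j ∈ S ω} ⊆ ⋃ s ∈ T, {ω | S ω = s} := by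
    intro ω hω
    have hω' : j ∈ S ω := hω
    simp [hT, hScard, hω']
  have hpos : (0 : ℝ) < (m + 1).choose (k + 1) := by exact_mod_cast Nat.choose_pos hbn
  have hcard : (T.card : ℝ) ≤ m.choose k := by
    have h := Finset.card_filter_mem_powersetCard_le Finset.univ k (Finset.mem_univ j)
    rw [Finset.card_fin, Nat.add_sub_cancel] at h
    exact_mod_cast h
  have hprob : ∀ s ∈ T, P.real {ω | S ω = s} = 1 / ((m + 1).choose (k + 1) : ℝ) := by
    intro s hs
    have hs' : s.card = k + 1 := (Finset.mem_powersetCard.mp (Finset.mem_filter.mp hs).1).2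
    simp [Measure.real, hSunif s hs']
  calc P.real {ω | j ∈ S ω} ≤ P.real (⋃ s ∈ T, {ω | S ω = s}) :=
        measureReal_mono hsub (measure_ne_top P _)
    _ ≤ ∑ s ∈ T, P.real {ω | S ω = s} := measureReal_biUnion_finset_le _ _
    _ = T.card * (1 / ((m + 1).choose (k + 1) : ℝ)) := by
      rw [Finset.sum_congr rfl hprob, Finset.sum_const, nsmul_eq_mul]
    _ ≤ m.choose k * (1 / ((m + 1).choose (k + 1) : ℝ)) := by gcongr
    _ = ((k + 1 : ℕ) : ℝ) / (m + 1 : ℕ) := by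
      have h : ((m + 1 : ℕ) : ℝ) * m.choose k = (m + 1).choose (k + 1) * (k + 1 : ℕ) := by
        exact_mod_cast Nat.add_one_mul_choose_eq m k
      have hm : ((m + 1 : ℕ) : ℝ) ≠ 0 := by positivity
      rw [mul_one_div, div_eq_div_iff hpos.ne' hm]
      linarith

/-- The gradient at `θ` of the quadratic loss `(⟪a, θ⟫ - y) ^ 2 / 2`
has norm at most `D ^ 2 * (1 + ‖θ‖)`. -/
theorem norm_inner_smul_sub_smul_le {E : Type*} [NormedAddCommGroup E] [InnerProductSpace ℝ E]
    {D : ℝ} {a : E} {y : ℝ} (ha : ‖a‖ ≤ D) (hy : |y| ≤ D) (θ : E) :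
    ‖⟪a, θ⟫_ℝ • a - y • a‖ ≤ D ^ 2 * (1 + ‖θ‖) := by
  have hD : 0 ≤ D := (norm_nonneg a).trans ha
  calc ‖⟪a, θ⟫_ℝ • a - y • a‖ ≤ ‖⟪a, θ⟫_ℝ • a‖ + ‖y • a‖ := norm_sub_le _ _
    _ = |⟪a, θ⟫_ℝ| * ‖a‖ + |y| * ‖a‖ := by simp [norm_smul]
    _ ≤ (‖a‖ * ‖θ‖) * ‖a‖ + |y| * ‖a‖ := by gcongr; exact abs_real_inner_le_norm a θ
    _ ≤ (D * ‖θ‖) * D + D * D := by gcongr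
    _ = D ^ 2 * (1 + ‖θ‖) := by ring

/-- one-step perturbation bound for SGD with quadratic loss, Lemma 3.3.
Two neighbouring datasets `(a i, y i)` and `(â i, ŷ i)` in `ℝ^d × ℝ`, bounded by `D`, differing
in at most one index.  `S` is a uniformly distributed random subset of `{1,…,n}` of cardinality
`b` (same minibatch for both chains).  With
`θ₁ = (I - (η/b) H₁) θ + (η/b) q₁` and `θ̂₁ = (I - (η/b) Ĥ₁) θ + (η/b) q̂₁`, where
`H₁ = ∑_{i∈S} a_i a_iᵀ`, `q₁ = ∑_{i∈S} y_i a_i` (and hatted versions), we have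
`E‖θ₁ - θ̂₁‖ ≤ (2ηD²/n)(1 + ‖θ‖)`. -/
theorem stmt_2
    {Ωs : Type*} [MeasurableSpace Ωs] (P : Measure Ωs) [IsProbabilityMeasure P]
    (d n b : ℕ) (hb : 1 ≤ b) (hbn : b ≤ n)
    (η D : ℝ) (hη : 0 < η) (hD : 0 < D)
    (a ah : Fin n → EuclideanSpace ℝ (Fin d)) (y yh : Fin n → ℝ)
    (hbound : ∀ i, ‖a i‖ ≤ D ∧ |y i| ≤ D ∧ ‖ah i‖ ≤ D ∧ |yh i| ≤ D)
    -- the two datasets differ in at most one index: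
    (hdiff : ∃ j : Fin n, ∀ i : Fin n, i ≠ j → a i = ah i ∧ y i = yh i)
    -- S is a uniformly distributed random subset of {1,…,n} of cardinality b:
    (S : Ωs → Finset (Fin n))
    (hScard : ∀ ω, (S ω).card = b)
    (hSmeas : ∀ s : Finset (Fin n), MeasurableSet {ω | S ω = s})
    (hSunif : ∀ s : Finset (Fin n), s.card = b →
      P {ω | S ω = s} = 1 / (n.choose b : ℝ≥0∞))
    (θ₀ : EuclideanSpace ℝ (Fin d))
    (θ1 θh1 : Ωs → EuclideanSpace ℝ (Fin d))
    (hθ1 : ∀ ω, θ1 ω = (θ₀ - (η / (b : ℝ)) • ∑ i ∈ S ω, ⟪a i, θ₀⟫_ℝ • a i)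
      + (η / (b : ℝ)) • ∑ i ∈ S ω, y i • a i)
    (hθh1 : ∀ ω, θh1 ω = (θ₀ - (η / (b : ℝ)) • ∑ i ∈ S ω, ⟪ah i, θ₀⟫_ℝ • ah i)
      + (η / (b : ℝ)) • ∑ i ∈ S ω, yh i • ah i) :
    (∫ ω, ‖θ1 ω - θh1 ω‖ ∂P) ≤ (2 * η * D ^ 2 / (n : ℝ)) * (1 + ‖θ₀‖) := by
  obtain ⟨j, hj⟩ := hdiff
  have hb0 : (0 : ℝ) < b := by exact_mod_cast hb
  set C : ℝ := η / b * (2 * (D ^ 2 * (1 + ‖θ₀‖))) with hC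
  have hC0 : 0 ≤ C := by positivity
  set g : Fin n → EuclideanSpace ℝ (Fin d) := fun i =>
    (⟪ah i, θ₀⟫_ℝ • ah i - yh i • ah i) - (⟪a i, θ₀⟫_ℝ • a i - y i • a i) with hg
  have hdiff_eq : ∀ ω, θ1 ω - θh1 ω = (η / (b : ℝ)) • ∑ i ∈ S ω, g i := by
    intro ω
    simp only [hθ1, hθh1, hg, Finset.sum_sub_distrib]
    module
  have hgz : ∀ i, i ≠ j → g i = 0 := by
    intro i hi
    simp [hg, hj i hi]
  have hgj : ‖g j‖ ≤ 2 * (D ^ 2 * (1 + ‖θ₀‖)) := by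
    obtain ⟨h1, h2, h3, h4⟩ := hbound j
    have := norm_sub_le (⟪ah j, θ₀⟫_ℝ • ah j - yh j • ah j) (⟪a j, θ₀⟫_ℝ • a j - y j • a j)
    linarith [norm_inner_smul_sub_smul_le h1 h2 θ₀, norm_inner_smul_sub_smul_le h3 h4 θ₀]
  have hpt : ∀ ω, ‖θ1 ω - θh1 ω‖ ≤ {ω | j ∈ S ω}.indicator (fun _ => C) ω := by
    intro ω
    rw [hdiff_eq]
    by_cases hω : j ∈ S ω
    · rw [Set.indicator_of_mem (show ω ∈ {ω | j ∈ S ω} from hω),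
        Finset.sum_eq_single_of_mem j hω fun i _ hi => hgz i hi, norm_smul,
        Real.norm_of_nonneg (by positivity), hC]
      gcongr
    · rw [Set.indicator_of_notMem (show ω ∉ {ω | j ∈ S ω} from hω),
        Finset.sum_eq_zero fun i hi => hgz i fun h => hω (h ▸ hi), smul_zero, norm_zero]
  have hmeas := measurableSet_mem_of_measurableSet_eq hSmeas j
  calc (∫ ω, ‖θ1 ω - θh1 ω‖ ∂P) ≤ ∫ ω, {ω | j ∈ S ω}.indicator (fun _ => C) ω ∂P :=
        integral_mono_of_nonneg (.of_forall fun _ => norm_nonneg _)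
          ((integrable_const C).indicator hmeas) (.of_forall hpt)
    _ = P.real {ω | j ∈ S ω} * C := by rw [integral_indicator_const _ hmeas, smul_eq_mul]
    _ ≤ b / n * C := by
      gcongr
      exact measureReal_mem_uniform_subset_le P hb hbn hScard hSunif j
    _ = (2 * η * D ^ 2 / (n : ℝ)) * (1 + ‖θ₀‖) := by
      rw [hC]
      field_simp
end

section
/- Fix integers d, d', n, b with 1 ≤ b ≤ n, a step-size η > 0, a dataset X̂ = (x̂_1, …, x̂_n) in ℝ^{d'} with ‖x̂_i‖ ≤ D for all i, and a measurable map g : ℝ^d × ℝ^{d'} → ℝ^d. Assume Assumption 1 and Assumption 2, that η < min{1/μ, μ/(K_1² + 64D²K_2²)}, and let θ̂_* ∈ ℝ^d satisfy (1/n)Σ_{i=1}^n g(θ̂_*, x̂_i) = 0. Let Ω_1 be a uniformly distributed random subset of {1, …, n} of cardinality b, fix θ ∈ ℝ^d, and set θ̂_1 = θ − (η/b)Σ_{i∈Ω_1} g(θ, x̂_i). Then E[1 + ‖θ̂_1 − θ̂_*‖²] ≤ (1 − ημ)(1 + ‖θ − θ̂_*‖²) + 2ημ − η²K_1² − 56η²D²K_2²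 + 64η²D²K_2²‖θ̂_*‖². -/
open MeasureTheory ProbabilityTheory
open scoped InnerProductSpace ENNReal

/-- Double counting: each point lies in `(n - 1).choose (b - 1)` of the `b`-subsets. -/
theorem sum_powersetCard_univ_sum {α M : Type*} [Fintype α] [AddCommMonoid M] {b : ℕ}
    (hb : 1 ≤ b) (f : α → M) :
    ∑ s ∈ (Finset.univ : Finset α).powersetCard b, ∑ i ∈ s, f i
      = (Fintype.card α - 1).choose (b - 1) • ∑ i, f i := by
  classical
  rw [Finset.sum_comm' (t' := Finset.univ)
    (s' := fun i => {s ∈ (Finset.univ : Finset α).powersetCard b | {i} ⊆ s}) (by simp),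
    Finset.smul_sum]
  refine Finset.sum_congr rfl fun i _ => ?_
  rw [Finset.sum_const, Finset.card_filter_powersetCard_subset _ _ _ (Finset.subset_univ _)
    (by simpa using hb), Finset.card_singleton, Finset.card_univ]

/-- The average over a uniformly random `b`-subset is an unbiased estimator of the mean. -/
theorem sum_powersetCard_univ_average {α E : Type*} [Fintype α] [AddCommGroup E] [Module ℝ E]
    {b : ℕ} (hb : 1 ≤ b) (hbn : b ≤ Fintype.card α) (f : α → E) :
    ∑ s ∈ (Finset.univ : Finset α).powersetCard b, (b : ℝ)⁻¹ • ∑ i ∈ s, f i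
      = ((Fintype.card α).choose b : ℝ) • (Fintype.card α : ℝ)⁻¹ • ∑ i, f i := by
  rw [← Finset.smul_sum, sum_powersetCard_univ_sum hb, ← Nat.cast_smul_eq_nsmul ℝ, smul_smul,
    smul_smul]
  congr 1
  generalize Fintype.card α = n at hbn
  obtain ⟨k, rfl⟩ : ∃ k, b = k + 1 := ⟨b - 1, by omega⟩
  obtain ⟨m, rfl⟩ : ∃ m, n = m + 1 := ⟨n - 1, by omega⟩
  have h : ((m : ℝ) + 1) * m.choose k = (m + 1).choose (k + 1) * ((k : ℝ) + 1) := by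
    exact_mod_cast Nat.add_one_mul_choose_eq m k
  simp only [Nat.add_sub_cancel]
  push_cast
  field_simp
  linarith

/-- The expectation of a function of a uniformly random `b`-subset is the average over all
`b`-subsets. -/
theorem integral_comp_uniform_powersetCard {Ω α : Type*} [MeasurableSpace Ω] [Fintype α]
    (P : Measure Ω) [IsProbabilityMeasure P] {b : ℕ} (S : Ω → Finset α)
    (hcard : ∀ ω, (S ω).card = b) (hmeas : ∀ s, MeasurableSet {ω | S ω = s})
    (hunif : ∀ s : Finset α, s.card = b →
      P {ω | S ω = s} = 1 / ((Fintype.card α).choose b : ℝ≥0∞))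
    (F : Finset α → ℝ) :
    ∫ ω, F (S ω) ∂P
      = ((Fintype.card α).choose b : ℝ)⁻¹ * ∑ s ∈ Finset.univ.powersetCard b, F s := by
  classical
  let : MeasurableSpace (Finset α) := ⊤
  have hS : Measurable S := measurable_to_countable' hmeas
  have : IsProbabilityMeasure (P.map S) := Measure.isProbabilityMeasure_map hS.aemeasurable
  have hF : Measurable F := measurable_from_top
  rw [← integral_map hS.aemeasurable hF.aestronglyMeasurable, integral_fintype .of_finite,
    Finset.mul_sum, ← Finset.sum_subset (Finset.subset_univ (Finset.univ.powersetCard b))]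
  · refine Finset.sum_congr rfl fun s hs => ?_
    have hs : P (S ⁻¹' {s}) = _ := hunif s (Finset.mem_powersetCard_univ.1 hs)
    rw [map_measureReal_apply hS (MeasurableSet.singleton s), measureReal_def, hs]
    simp
  · intro s _ hs
    have hs : S ⁻¹' {s} = ∅ := by
      ext ω
      simp only [Set.mem_preimage, Set.mem_singleton_iff, Set.mem_empty_iff_false, iff_false]
      rintro rfl
      exact hs (Finset.mem_powersetCard_univ.2 (hcard ω))
    rw [map_measureReal_apply hS (MeasurableSet.singleton s), hs]
    simp

/-- Bias–variance bound for a gradient step with an unbiased gradient estimator of bounded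
deviation. -/
theorem sum_norm_sub_smul_sq_le {ι E : Type*} [NormedAddCommGroup E] [InnerProductSpace ℝ E]
    (T : Finset ι) (h : ι → E) (v G : E) (η B : ℝ)
    (hmean : ∑ s ∈ T, h s = (T.card : ℝ) • G) (hdev : ∀ s ∈ T, ‖h s - G‖ ^ 2 ≤ B) :
    ∑ s ∈ T, ‖v - η • h s‖ ^ 2 ≤ T.card * (‖v - η • G‖ ^ 2 + η ^ 2 * B) := by
  have hstep : ∀ s ∈ T, ‖v - η • h s‖ ^ 2
      ≤ (‖v - η • G‖ ^ 2 + η ^ 2 * B) - 2 * η * ⟪v - η • G, h s - G⟫_ℝ := by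
    intro s hs
    have hsplit : v - η • h s = (v - η • G) - η • (h s - G) := by module
    rw [hsplit, norm_sub_sq_real, real_inner_smul_right, norm_smul, mul_pow, Real.norm_eq_abs,
      sq_abs]
    nlinarith [mul_le_mul_of_nonneg_left (hdev s hs) (sq_nonneg η)]
  have hzero : ∑ s ∈ T, (h s - G) = 0 := by
    rw [Finset.sum_sub_distrib, hmean, Finset.sum_const, ← Nat.cast_smul_eq_nsmul ℝ, sub_self]
  calc ∑ s ∈ T, ‖v - η • h s‖ ^ 2
      ≤ ∑ s ∈ T, ((‖v - η • G‖ ^ 2 + η ^ 2 * B) - 2 * η * ⟪v - η • G, h s - G⟫_ℝ) :=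
        Finset.sum_le_sum hstep
    _ = T.card * (‖v - η • G‖ ^ 2 + η ^ 2 * B) := by
        rw [Finset.sum_sub_distrib, ← Finset.mul_sum, ← inner_sum, hzero]
        simp [mul_add]

/-- An average stays within `C` of a point if all the averaged vectors do. -/
theorem norm_average_sub_le {ι E : Type*} [NormedAddCommGroup E] [NormedSpace ℝ E]
    {s : Finset ι} (hs : 0 < s.card) (f : ι → E) (w : E) {C : ℝ}
    (h : ∀ i ∈ s, ‖f i - w‖ ≤ C) : ‖(s.card : ℝ)⁻¹ • ∑ i ∈ s, f i - w‖ ≤ C := by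
  have hs' : (0 : ℝ) < s.card := by exact_mod_cast hs
  have hw : (s.card : ℝ)⁻¹ • ∑ i ∈ s, f i - w = (s.card : ℝ)⁻¹ • ∑ i ∈ s, (f i - w) := by
    rw [Finset.sum_sub_distrib, Finset.sum_const, ← Nat.cast_smul_eq_nsmul ℝ, smul_sub, smul_smul,
      inv_mul_cancel₀ hs'.ne', one_smul]
  rw [hw, norm_smul, norm_inv, Real.norm_natCast, inv_mul_le_iff₀ hs', ← nsmul_eq_mul]
  exact norm_sum_le_of_le s h |>.trans_eq (Finset.sum_const C)

/-- Lemma B.2: one-step Lyapunov drift for SGD under strong convexity.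
With `θ̂₁ = θ - (η/b) ∑_{i∈Ω₁} g(θ, x̂ᵢ)` for a uniformly distributed minibatch `Ω₁` of size `b`
on a `D`-bounded dataset `x̂`, `θ̂_*` a critical point of the empirical risk, and with
Assumptions 1 and 2 and `η < min{1/μ, μ/(K₁² + 64 D² K₂²)}`,
`E[1 + ‖θ̂₁ - θ̂_*‖²] ≤ (1-ημ)(1 + ‖θ - θ̂_*‖²) + 2ημ - η²K₁² - 56η²D²K₂² + 64η²D²K₂²‖θ̂_*‖²`. -/
theorem stmt_6
    {Ωs : Type*} [MeasurableSpace Ωs] (P : Measure Ωs) [IsProbabilityMeasure P]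
    (d d' n b : ℕ) (hb : 1 ≤ b) (hbn : b ≤ n)
    (η D K1 K2 μ : ℝ) (hη : 0 < η) (hD : 0 < D) (hK1 : 0 < K1) (hK2 : 0 < K2) (hμ : 0 < μ)
    (g : EuclideanSpace ℝ (Fin d) → EuclideanSpace ℝ (Fin d') → EuclideanSpace ℝ (Fin d))
    (hgmeas : Measurable (Function.uncurry g))
    -- Assumption 1 (pseudo-Lipschitz gradient):
    (hA1 : ∀ (θ θ' : EuclideanSpace ℝ (Fin d)) (z z' : EuclideanSpace ℝ (Fin d')),
      ‖g θ z - g θ' z'‖ ≤ K1 * ‖θ - θ'‖ + K2 * ‖z - z'‖ * (‖θ‖ + ‖θ'‖ + 1))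
    -- Assumption 2 (strong convexity):
    (hA2 : ∀ (θ1 θ2 : EuclideanSpace ℝ (Fin d)) (z : EuclideanSpace ℝ (Fin d')),
      μ * ‖θ1 - θ2‖ ^ 2 ≤ ⟪g θ1 z - g θ2 z, θ1 - θ2⟫_ℝ)
    -- step-size condition:
    (hηsmall : η < min (1 / μ) (μ / (K1 ^ 2 + 64 * D ^ 2 * K2 ^ 2)))
    -- the dataset, bounded by D:
    (xh : Fin n → EuclideanSpace ℝ (Fin d')) (hxhD : ∀ i, ‖xh i‖ ≤ D)
    -- θ̂_* is a critical point of the empirical risk: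
    (θstar : EuclideanSpace ℝ (Fin d))
    (hθstar : (1 / (n : ℝ)) • ∑ i : Fin n, g θstar (xh i) = 0)
    -- Ω₁ is a uniformly distributed random subset of {1,…,n} of cardinality b:
    (S : Ωs → Finset (Fin n))
    (hScard : ∀ ω, (S ω).card = b)
    (hSmeas : ∀ s : Finset (Fin n), MeasurableSet {ω | S ω = s})
    (hSunif : ∀ s : Finset (Fin n), s.card = b →
      P {ω | S ω = s} = 1 / (n.choose b : ℝ≥0∞))
    -- one SGD step from θ₀:
    (θ₀ : EuclideanSpace ℝ (Fin d))
    (θh1 : Ωs → EuclideanSpace ℝ (Fin d))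
    (hθh1 : ∀ ω, θh1 ω = θ₀ - (η / (b : ℝ)) • ∑ i ∈ S ω, g θ₀ (xh i)) :
    (∫ ω, (1 + ‖θh1 ω - θstar‖ ^ 2) ∂P)
      ≤ (1 - η * μ) * (1 + ‖θ₀ - θstar‖ ^ 2)
        + 2 * η * μ - η ^ 2 * K1 ^ 2 - 56 * η ^ 2 * D ^ 2 * K2 ^ 2
        + 64 * η ^ 2 * D ^ 2 * K2 ^ 2 * ‖θstar‖ ^ 2 := by
  have hn : 0 < n := by omega
  have hn' : (0 : ℝ) < n := by exact_mod_cast hn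
  have hnb : ((n.choose b : ℕ) : ℝ) ≠ 0 := by exact_mod_cast (Nat.choose_pos hbn).ne'
  have hcard : (Finset.univ : Finset (Fin n)).card = n := by simp
  have hstar : ∑ i : Fin n, g θstar (xh i) = 0 := by
    refine (smul_eq_zero.1 hθstar).resolve_left ?_
    positivity
  set G : EuclideanSpace ℝ (Fin d) := (n : ℝ)⁻¹ • ∑ i, g θ₀ (xh i) with hG
  set u := ‖θ₀ - θstar‖ with hu
  have hGnorm : ‖G‖ ≤ K1 * u := by
    have hG' : G = (n : ℝ)⁻¹ • ∑ i, (g θ₀ (xh i) - g θstar (xh i)) := by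
      rw [Finset.sum_sub_distrib, hstar, sub_zero]
    have := norm_average_sub_le (s := (Finset.univ : Finset (Fin n))) (by rwa [hcard])
      (fun i => g θ₀ (xh i) - g θstar (xh i)) 0 (C := K1 * u)
      (fun i _ => by simpa using hA1 θ₀ θstar (xh i) (xh i))
    rwa [hcard, sub_zero, ← hG'] at this
  have hGinner : μ * u ^ 2 ≤ ⟪θ₀ - θstar, G⟫_ℝ := by
    have hsum := Finset.sum_le_sum fun i (_ : i ∈ Finset.univ) => hA2 θ₀ θstar (xh i)
    rw [← sum_inner, Finset.sum_sub_distrib, hstar, sub_zero, Finset.sum_const, hcard,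
      nsmul_eq_mul] at hsum
    rw [hG, real_inner_smul_right, real_inner_comm, inv_mul_eq_div, le_div_iff₀ hn']
    linarith
  have hdev : ∀ s ∈ (Finset.univ : Finset (Fin n)).powersetCard b,
      ‖(b : ℝ)⁻¹ • ∑ i ∈ s, g θ₀ (xh i) - G‖ ^ 2 ≤ (K2 * (2 * D) * (2 * ‖θ₀‖ + 1)) ^ 2 := by
    intro s hs
    have hsb := Finset.mem_powersetCard_univ.1 hs
    gcongr
    rw [← hsb]
    refine norm_average_sub_le (by omega) _ _ fun i _ => ?_
    rw [norm_sub_rev]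
    have := norm_average_sub_le (s := (Finset.univ : Finset (Fin n))) (by rwa [hcard])
      (fun j => g θ₀ (xh j)) (g θ₀ (xh i)) (C := K2 * (2 * D) * (2 * ‖θ₀‖ + 1)) fun j _ => by
        refine (hA1 θ₀ θ₀ (xh j) (xh i)).trans ?_
        have hx : ‖xh j - xh i‖ ≤ 2 * D :=
          (norm_sub_le _ _).trans (by linarith [hxhD i, hxhD j])
        rw [sub_self, norm_zero, mul_zero, zero_add, ← two_mul]
        gcongr
    rwa [hcard] at this
  have hmean : ∑ s ∈ (Finset.univ : Finset (Fin n)).powersetCard b,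
      (b : ℝ)⁻¹ • ∑ i ∈ s, g θ₀ (xh i)
      = (((Finset.univ : Finset (Fin n)).powersetCard b).card : ℝ) • G := by
    rw [sum_powersetCard_univ_average hb (by simpa using hbn), Finset.card_powersetCard, hcard,
      Fintype.card_fin]
  have hsum := sum_norm_sub_smul_sq_le _ _ (θ₀ - θstar) G η _ hmean hdev
  have hint : ∫ ω, (1 + ‖θh1 ω - θstar‖ ^ 2) ∂P
      ≤ 1 + (‖(θ₀ - θstar) - η • G‖ ^ 2 + η ^ 2 * (K2 * (2 * D) * (2 * ‖θ₀‖ + 1)) ^ 2) := by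
    have hF : ∀ ω, 1 + ‖θh1 ω - θstar‖ ^ 2
        = 1 + ‖(θ₀ - θstar) - η • (b : ℝ)⁻¹ • ∑ i ∈ S ω, g θ₀ (xh i)‖ ^ 2 := by
      intro ω
      rw [hθh1, smul_smul, ← div_eq_mul_inv, sub_right_comm]
    simp_rw [hF]
    rw [integral_comp_uniform_powersetCard P S hScard hSmeas (by simpa using hSunif)
      (fun s => 1 + ‖(θ₀ - θstar) - η • (b : ℝ)⁻¹ • ∑ i ∈ s, g θ₀ (xh i)‖ ^ 2),
      Finset.sum_add_distrib, Finset.sum_const, Finset.card_powersetCard, hcard, Fintype.card_fin,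
      nsmul_one, inv_mul_le_iff₀ (by positivity)]
    rw [Finset.card_powersetCard, hcard] at hsum
    linarith
  have hη2 : η * (K1 ^ 2 + 64 * D ^ 2 * K2 ^ 2) ≤ μ :=
    ((lt_div_iff₀ (by positivity)).1 (hηsmall.trans_le (min_le_right _ _))).le
  have hθ : ‖θ₀‖ ≤ u + ‖θstar‖ := by
    simpa [hu] using norm_add_le (θ₀ - θstar) θstar
  have hvar : (K2 * (2 * D) * (2 * ‖θ₀‖ + 1)) ^ 2
      ≤ D ^ 2 * K2 ^ 2 * (64 * u ^ 2 + 64 * ‖θstar‖ ^ 2 + 8) := by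
    have hsq : 4 * (2 * ‖θ₀‖ + 1) ^ 2 ≤ 64 * u ^ 2 + 64 * ‖θstar‖ ^ 2 + 8 := by
      nlinarith [pow_le_pow_left₀ (norm_nonneg θ₀) hθ 2, sq_nonneg (u - ‖θstar‖),
        sq_nonneg (2 * ‖θ₀‖ - 1)]
    calc _ = D ^ 2 * K2 ^ 2 * (4 * (2 * ‖θ₀‖ + 1) ^ 2) := by ring
      _ ≤ _ := by gcongr
  have hstep : ‖(θ₀ - θstar) - η • G‖ ^ 2
      ≤ u ^ 2 - 2 * η * (μ * u ^ 2) + η ^ 2 * (K1 * u) ^ 2 := by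
    rw [norm_sub_sq_real, real_inner_smul_right, norm_smul, mul_pow, Real.norm_eq_abs, sq_abs, ← hu]
    have h1 := mul_le_mul_of_nonneg_left hGinner hη.le
    have h2 : η ^ 2 * ‖G‖ ^ 2 ≤ η ^ 2 * (K1 * u) ^ 2 := by gcongr
    linarith
  have hvar' := mul_le_mul_of_nonneg_left hvar (sq_nonneg η)
  have hdrift := mul_le_mul_of_nonneg_left hη2 (by positivity : 0 ≤ η * (1 + u ^ 2))
  linarith
end

section
/- Fix integers d, d', n, b with 1 ≤ b ≤ n, a step-size η > 0, and two datasets X = (x_1, …, x_n) and X̂ = (x̂_1, …, x̂_n) in ℝ^{d'} differing in at most one index, with ‖x_i‖ ≤ D and ‖x̂_i‖ ≤ D for all i. Let g : ℝ^d × ℝ^{d'} → ℝ^d satisfy Assumption 1. Let Ω_1 be a uniformly distributed random subset of {1, …, n} of cardinality b, fix θ ∈ ℝ^d, and set θ_1 = θ − (η/b)Σ_{i∈Ω_1} g(θ, x_i) and θ̂_1 = θ − (η/b)Σ_{i∈Ω_1} g(θ, x̂_i) (same Ω_1 for both). Then E‖θ_1 − θ̂_1‖ ≤ (2DK_2η/n)(2‖θ‖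 + 1). -/
open MeasureTheory ProbabilityTheory
open scoped InnerProductSpace ENNReal

/-- Each element of `Fin n` lies in `(n - 1).choose (b - 1)` of the subsets of cardinality `b`. -/
lemma card_filter_mem_powersetCard_univ (n b : ℕ) (j : Fin (n + 1)) :
    (((Finset.univ : Finset (Fin (n + 1))).powersetCard (b + 1)).filter (j ∈ ·)).card =
      n.choose b := by
  have hcompl : ((Finset.univ : Finset (Fin (n + 1))).powersetCard (b + 1)).filter (j ∉ ·) =
      (Finset.univ.erase j).powersetCard (b + 1) := by
    ext s
    simp only [Finset.mem_filter, Finset.mem_powersetCard, Finset.subset_univ, true_and,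
      Finset.subset_erase]
    exact and_comm
  have hsplit := Finset.card_filter_add_card_filter_not
    (s := (Finset.univ : Finset (Fin (n + 1))).powersetCard (b + 1)) (j ∈ ·)
  rw [hcompl, Finset.card_powersetCard, Finset.card_powersetCard,
    Finset.card_erase_of_mem (Finset.mem_univ j), Finset.card_univ, Fintype.card_fin,
    Nat.add_sub_cancel, Nat.choose_succ_succ'] at hsplit
  omega

/-- A uniformly distributed subset of cardinality `b` of `Fin n` contains a given element with
probability `b / n`. -/
lemma measureReal_mem_uniform_subset {Ω : Type*} [MeasurableSpace Ω] (P : Measure Ω)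
    [IsFiniteMeasure P] {n b : ℕ} (hb : 1 ≤ b) (hbn : b ≤ n) (S : Ω → Finset (Fin n))
    (hScard : ∀ ω, (S ω).card = b) (hSmeas : ∀ s, MeasurableSet {ω | S ω = s})
    (hSunif : ∀ s : Finset (Fin n), s.card = b →
      P {ω | S ω = s} = 1 / (n.choose b : ℝ≥0∞)) (j : Fin n) :
    P.real {ω | j ∈ S ω} = b / n := by
  obtain ⟨b, rfl⟩ := Nat.exists_eq_add_of_le' hb
  obtain ⟨n, rfl⟩ := Nat.exists_eq_add_of_le' (hb.trans hbn)
  have hunion : {ω | j ∈ S ω} =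
      ⋃ s ∈ ((Finset.univ : Finset (Fin (n + 1))).powersetCard (b + 1)).filter (j ∈ ·),
        {ω | S ω = s} := by
    ext ω
    simp [hScard]
  have hreal : ∀ s ∈ ((Finset.univ : Finset (Fin (n + 1))).powersetCard (b + 1)).filter (j ∈ ·),
      P.real {ω | S ω = s} = 1 / ((n + 1).choose (b + 1) : ℝ) := by
    intro s hs
    rw [measureReal_def, hSunif s (by simpa using (Finset.mem_filter.1 hs).1)]
    simp
  rw [hunion, measureReal_biUnion_finset _ fun s _ => hSmeas s, Finset.sum_congr rfl hreal,
    Finset.sum_const, card_filter_mem_powersetCard_univ, nsmul_eq_mul, mul_one_div,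
    div_eq_div_iff]
  · have h := Nat.add_one_mul_choose_eq n b
    rw [mul_comm (n.choose b : ℝ), mul_comm ((b + 1 : ℕ) : ℝ)]
    exact_mod_cast h
  · exact_mod_cast (Nat.choose_pos hbn).ne'
  · positivity
  · intro s _ t _ hst
    exact Set.disjoint_left.2 fun ω hs ht => hst (hs.symm.trans ht)

/-- core of Lemma B.3: one-step perturbation bound between neighbouring
datasets.  With `θ₁ = θ - (η/b) ∑_{i∈Ω₁} g(θ, xᵢ)` and `θ̂₁ = θ - (η/b) ∑_{i∈Ω₁} g(θ, x̂ᵢ)`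
(same uniformly distributed minibatch `Ω₁` of size `b`) on `D`-bounded datasets differing in
at most one index, under Assumption 1, `E‖θ₁ - θ̂₁‖ ≤ (2 D K₂ η / n)(2‖θ‖ + 1)`. -/
theorem stmt_7
    {Ωs : Type*} [MeasurableSpace Ωs] (P : Measure Ωs) [IsProbabilityMeasure P]
    (d d' n b : ℕ) (hb : 1 ≤ b) (hbn : b ≤ n)
    (η D K1 K2 : ℝ) (hη : 0 < η) (hD : 0 < D) (hK1 : 0 < K1) (hK2 : 0 < K2)
    (g : EuclideanSpace ℝ (Fin d) → EuclideanSpace ℝ (Fin d') → EuclideanSpace ℝ (Fin d))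
    (hgmeas : Measurable (Function.uncurry g))
    -- Assumption 1 (pseudo-Lipschitz gradient):
    (hA1 : ∀ (θ θ' : EuclideanSpace ℝ (Fin d)) (z z' : EuclideanSpace ℝ (Fin d')),
      ‖g θ z - g θ' z'‖ ≤ K1 * ‖θ - θ'‖ + K2 * ‖z - z'‖ * (‖θ‖ + ‖θ'‖ + 1))
    -- the two datasets, bounded by D and differing in at most one index:
    (x xh : Fin n → EuclideanSpace ℝ (Fin d'))
    (hxD : ∀ i, ‖x i‖ ≤ D) (hxhD : ∀ i, ‖xh i‖ ≤ D)
    (hdiff : ∃ j : Fin n, ∀ i : Fin n, i ≠ j → x i = xh i)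
    -- Ω₁ is a uniformly distributed random subset of {1,…,n} of cardinality b:
    (S : Ωs → Finset (Fin n))
    (hScard : ∀ ω, (S ω).card = b)
    (hSmeas : ∀ s : Finset (Fin n), MeasurableSet {ω | S ω = s})
    (hSunif : ∀ s : Finset (Fin n), s.card = b →
      P {ω | S ω = s} = 1 / (n.choose b : ℝ≥0∞))
    -- one SGD step from θ₀ on each dataset (same minibatch):
    (θ₀ : EuclideanSpace ℝ (Fin d))
    (θ1 θh1 : Ωs → EuclideanSpace ℝ (Fin d))
    (hθ1 : ∀ ω, θ1 ω = θ₀ - (η / (b : ℝ)) • ∑ i ∈ S ω, g θ₀ (x i))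
    (hθh1 : ∀ ω, θh1 ω = θ₀ - (η / (b : ℝ)) • ∑ i ∈ S ω, g θ₀ (xh i)) :
    (∫ ω, ‖θ1 ω - θh1 ω‖ ∂P) ≤ (2 * D * K2 * η / (n : ℝ)) * (2 * ‖θ₀‖ + 1) := by
  obtain ⟨j, hj⟩ := hdiff
  have hmeas : MeasurableSet {ω | j ∈ S ω} := by
    have hunion : {ω | j ∈ S ω} = ⋃ s ∈ {s : Finset (Fin n) | j ∈ s}, {ω | S ω = s} := by
      ext ω
      simp
    rw [hunion]
    exact MeasurableSet.biUnion (Set.to_countable _) fun s _ => hSmeas s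
  have hgrad : ‖g θ₀ (xh j) - g θ₀ (x j)‖ ≤ K2 * (2 * D) * (2 * ‖θ₀‖ + 1) := by
    have hdist : ‖xh j - x j‖ ≤ 2 * D :=
      (norm_sub_le _ _).trans (by linarith [hxD j, hxhD j])
    calc ‖g θ₀ (xh j) - g θ₀ (x j)‖
        ≤ K1 * ‖θ₀ - θ₀‖ + K2 * ‖xh j - x j‖ * (‖θ₀‖ + ‖θ₀‖ + 1) := hA1 ..
      _ = K2 * ‖xh j - x j‖ * (2 * ‖θ₀‖ + 1) := by rw [sub_self, norm_zero]; ring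
      _ ≤ K2 * (2 * D) * (2 * ‖θ₀‖ + 1) := by gcongr
  have hpoint : ∀ ω, ‖θ1 ω - θh1 ω‖ ≤ {ω | j ∈ S ω}.indicator
      (fun _ => η / b * (K2 * (2 * D) * (2 * ‖θ₀‖ + 1))) ω := by
    intro ω
    rw [hθ1, hθh1, sub_sub_sub_cancel_left, ← smul_sub, ← Finset.sum_sub_distrib]
    by_cases hω : j ∈ S ω
    · rw [Set.indicator_of_mem (show ω ∈ {ω | j ∈ S ω} from hω), Finset.sum_eq_single_of_mem j hω
        fun i _ hi => by rw [hj i hi, sub_self], norm_smul, Real.norm_of_nonneg (by positivity)]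
      gcongr
    · rw [Set.indicator_of_notMem (show ω ∉ {ω | j ∈ S ω} from hω), Finset.sum_eq_zero
        fun i hi => by rw [hj i (ne_of_mem_of_not_mem hi hω), sub_self], smul_zero, norm_zero]
  calc ∫ ω, ‖θ1 ω - θh1 ω‖ ∂P
      ≤ ∫ ω, {ω | j ∈ S ω}.indicator
          (fun _ => η / b * (K2 * (2 * D) * (2 * ‖θ₀‖ + 1))) ω ∂P :=
        integral_mono_of_nonneg (.of_forall fun _ => norm_nonneg _)
          ((integrable_const _).indicator hmeas) (.of_forall hpoint)
    _ = b / n * (η / b * (K2 * (2 * D) * (2 * ‖θ₀‖ + 1))) := by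
        rw [integral_indicator_const _ hmeas,
          measureReal_mem_uniform_subset P hb hbn S hScard hSmeas hSunif j, smul_eq_mul]
    _ = (2 * D * K2 * η / (n : ℝ)) * (2 * ‖θ₀‖ + 1) := by
        have hb0 : (b : ℝ) ≠ 0 := by positivity
        have hn0 : (n : ℝ) ≠ 0 := by
          have := hb.trans hbn
          positivity
        field_simp
end

section
/- Fix integers d, d', n, b with 1 ≤ b ≤ n, a step-size η > 0, a dataset X = (x_1, …, x_n) in ℝ^{d'}, and a measurable map g : ℝ^d × ℝ^{d'} → ℝ^d satisfying: there exists K_1 > 0 with ‖g(θ, x) − g(θ', x)‖ ≤ K_1‖θ − θ'‖ for all θ, θ' ∈ ℝ^d and all x ∈ {x_1, …, x_n}. Fix θ_* ∈ ℝ^d and set G_* := max_{1≤i≤n} ‖g(θ_*, x_i)‖. Let Ω_1 be a uniformly distributed random subset of {1, …, n} of cardinality b and let ξ be an ℝ^d-valued random vector independent of Ω_1 with E[ξ] = 0 and E‖ξ‖² = σ² < ∞. Fix θ ∈ ℝ^d and set θ_1 = θ − (η/b)Σ_{i∈Ω_1} g(θ, x_i) + ηξ. Then E‖θ_1 − θ_*‖²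 ≤ η²σ² + (2 + 4η²K_1²)‖θ − θ_*‖² + 4η²G_*². -/
open MeasureTheory ProbabilityTheory
open scoped InnerProductSpace ENNReal

section FiniteValuedIndependence

variable {Ωs ι E : Type*} [MeasurableSpace Ωs] {P : Measure Ωs}
  [NormedAddCommGroup E] [InnerProductSpace ℝ E] [MeasurableSpace E] [BorelSpace E]

/-- A centered random vector independent of an event has zero integral over that event. -/
theorem setIntegral_eq_zero_of_forall_measure_inter_preimage [SecondCountableTopology E]
    {ξ : Ωs → E} (hξ : Measurable ξ) (hmean : ∫ ω, ξ ω ∂P = 0) {B : Set Ωs}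
    (hindep : ∀ A : Set E, MeasurableSet A → P (B ∩ ξ ⁻¹' A) = P B * P (ξ ⁻¹' A)) :
    ∫ ω in B, ξ ω ∂P = 0 := by
  have hmap : (P.restrict B).map ξ = P B • P.map ξ := by
    ext A hA
    rw [Measure.map_apply hξ hA, Measure.restrict_apply (hξ hA), Measure.smul_apply,
      Measure.map_apply hξ hA, Set.inter_comm, hindep A hA, smul_eq_mul]
  have hid (μ : Measure Ωs) : ∫ ω, ξ ω ∂μ = ∫ y, y ∂(μ.map ξ) :=
    (integral_map hξ.aemeasurable aestronglyMeasurable_id).symm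
  rw [hid, hmap, integral_smul_measure, ← hid, hmean, smul_zero]

/-- A function of a finite-valued random variable is orthogonal in mean to an independent
centered random vector. -/
theorem integrable_and_integral_inner_eq_zero [Fintype ι] [SecondCountableTopology E]
    [CompleteSpace E] {S : Ωs → ι}
    (hS : ∀ s, MeasurableSet {ω | S ω = s}) {ξ : Ωs → E} (hξ : Measurable ξ)
    (hint : Integrable ξ P) (hmean : ∫ ω, ξ ω ∂P = 0)
    (hindep : ∀ (s : ι) (A : Set E), MeasurableSet A →
      P ({ω | S ω = s} ∩ ξ ⁻¹' A) = P {ω | S ω = s} * P (ξ ⁻¹' A)) (v : ι → E) :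
    Integrable (fun ω => ⟪v (S ω), ξ ω⟫_ℝ) P ∧ ∫ ω, ⟪v (S ω), ξ ω⟫_ℝ ∂P = 0 := by
  classical
  have hsum : (fun ω => ⟪v (S ω), ξ ω⟫_ℝ) =
      fun ω => ∑ s, {ω | S ω = s}.indicator (fun ω => ⟪v s, ξ ω⟫_ℝ) ω := by
    ext ω
    simp [Set.indicator_apply]
  have hi (s : ι) : Integrable ({ω | S ω = s}.indicator (fun ω => ⟪v s, ξ ω⟫_ℝ)) P :=
    (hint.const_inner (v s)).indicator (hS s)
  rw [hsum]
  refine ⟨integrable_finsetSum _ fun s _ => hi s, ?_⟩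
  rw [integral_finsetSum _ fun s _ => hi s]
  refine Finset.sum_eq_zero fun s _ => ?_
  rw [integral_indicator (hS s), integral_inner hint.integrableOn,
    setIntegral_eq_zero_of_forall_measure_inter_preimage hξ hmean (hindep s), inner_zero_right]

/-- Second moment bound for a bounded function of a finite-valued random variable perturbed by
an independent centered noise. -/
theorem integral_norm_add_smul_sq_le [Fintype ι] [SecondCountableTopology E]
    [CompleteSpace E] [IsProbabilityMeasure P] {S : Ωs → ι}
    (hS : ∀ s, MeasurableSet {ω | S ω = s}) {ξ : Ωs → E} (hξ : Measurable ξ)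
    (hint : Integrable ξ P) (hmean : ∫ ω, ξ ω ∂P = 0)
    (hint2 : Integrable (fun ω => ‖ξ ω‖ ^ 2) P)
    (hindep : ∀ (s : ι) (A : Set E), MeasurableSet A →
      P ({ω | S ω = s} ∩ ξ ⁻¹' A) = P {ω | S ω = s} * P (ξ ⁻¹' A))
    (v : ι → E) (η : ℝ) {C : ℝ} (hC : ∀ ω, ‖v (S ω)‖ ^ 2 ≤ C) :
    ∫ ω, ‖v (S ω) + η • ξ ω‖ ^ 2 ∂P ≤ C + η ^ 2 * ∫ ω, ‖ξ ω‖ ^ 2 ∂P := by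
  obtain ⟨hi, h0⟩ := integrable_and_integral_inner_eq_zero hS hξ hint hmean hindep v
  have hCi : Integrable (fun ω => C + 2 * η * ⟪v (S ω), ξ ω⟫_ℝ) P :=
    (integrable_const C).add (hi.const_mul _)
  calc ∫ ω, ‖v (S ω) + η • ξ ω‖ ^ 2 ∂P
      ≤ ∫ ω, (C + 2 * η * ⟪v (S ω), ξ ω⟫_ℝ + η ^ 2 * ‖ξ ω‖ ^ 2) ∂P := by
        refine integral_mono_of_nonneg (.of_forall fun ω => by positivity)
          (hCi.add (hint2.const_mul _)) (.of_forall fun ω => ?_)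
        have h := hC ω
        simp only [norm_add_sq_real, inner_smul_right, norm_smul, mul_pow, Real.norm_eq_abs,
          sq_abs]
        linarith
    _ = C + η ^ 2 * ∫ ω, ‖ξ ω‖ ^ 2 ∂P := by
        rw [integral_add hCi (hint2.const_mul _),
          integral_add (integrable_const C) (hi.const_mul _), integral_const_mul,
          integral_const_mul, h0]
        simp

end FiniteValuedIndependence

/-- A gradient-type step along an average of `b` vectors of norm at most `K * ‖u‖ + G`. -/
theorem norm_sub_smul_sum_sq_le {ι E : Type*} [SeminormedAddCommGroup E] [NormedSpace ℝ E]
    {s : Finset ι} {b : ℕ} (hb : b ≠ 0) (hs : s.card = b) (u : E) {w : ι → E} {K G η : ℝ}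
    (hη : 0 ≤ η) (hw : ∀ i ∈ s, ‖w i‖ ≤ K * ‖u‖ + G) :
    ‖u - (η / (b : ℝ)) • ∑ i ∈ s, w i‖ ^ 2
      ≤ (2 + 4 * η ^ 2 * K ^ 2) * ‖u‖ ^ 2 + 4 * η ^ 2 * G ^ 2 := by
  have hsum : ‖(η / (b : ℝ)) • ∑ i ∈ s, w i‖ ≤ η * (K * ‖u‖ + G) := by
    rw [norm_smul, Real.norm_of_nonneg (by positivity)]
    calc η / b * ‖∑ i ∈ s, w i‖ ≤ η / b * (b * (K * ‖u‖ + G)) := by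
          gcongr
          simpa [hs, mul_add] using norm_sum_le_of_le s hw
      _ = η * (K * ‖u‖ + G) := by field_simp
  calc ‖u - (η / (b : ℝ)) • ∑ i ∈ s, w i‖ ^ 2 ≤ (‖u‖ + η * (K * ‖u‖ + G)) ^ 2 := by
        gcongr
        exact (norm_sub_le _ _).trans (by gcongr)
    _ ≤ _ := by
        nlinarith [sq_nonneg (‖u‖ - η * (K * ‖u‖ + G)), sq_nonneg (η * (K * ‖u‖ - G))]

/-- moment estimate inside Lemma C.4 / lem:nonconvex:3.  With
`θ₁ = θ - (η/b) ∑_{i∈Ω₁} g(θ, xᵢ) + η ξ`, `Ω₁` a uniform minibatch of size `b`, `ξ` a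
centered noise with `E‖ξ‖² = σ²` independent of `Ω₁`, and `g` `K₁`-Lipschitz in `θ` along
the data points, `E‖θ₁ - θ_*‖² ≤ η²σ² + (2 + 4η²K₁²)‖θ - θ_*‖² + 4η²G_*²`, where
`G_* = maxᵢ ‖g(θ_*, xᵢ)‖`. -/
theorem stmt_11
    {Ωs : Type*} [MeasurableSpace Ωs] (P : Measure Ωs) [IsProbabilityMeasure P]
    (d d' n b : ℕ) (hn : 0 < n) (hb : 1 ≤ b) (hbn : b ≤ n)
    (η K1 σ : ℝ) (hη : 0 < η) (hK1 : 0 < K1)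
    (g : EuclideanSpace ℝ (Fin d) → EuclideanSpace ℝ (Fin d') → EuclideanSpace ℝ (Fin d))
    (hgmeas : Measurable (Function.uncurry g))
    (x : Fin n → EuclideanSpace ℝ (Fin d'))
    -- Lipschitz in θ along the data points:
    (hLip : ∀ (θ θ' : EuclideanSpace ℝ (Fin d)) (i : Fin n),
      ‖g θ (x i) - g θ' (x i)‖ ≤ K1 * ‖θ - θ'‖)
    (θstar : EuclideanSpace ℝ (Fin d))
    -- Ω₁ is a uniformly distributed random subset of {1,…,n} of cardinality b:
    (S : Ωs → Finset (Fin n))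
    (hScard : ∀ ω, (S ω).card = b)
    (hSmeas : ∀ s : Finset (Fin n), MeasurableSet {ω | S ω = s})
    (hSunif : ∀ s : Finset (Fin n), s.card = b →
      P {ω | S ω = s} = 1 / (n.choose b : ℝ≥0∞))
    -- ξ is a centered noise with E‖ξ‖² = σ² < ∞, independent of Ω₁:
    (ξ : Ωs → EuclideanSpace ℝ (Fin d)) (hξmeas : Measurable ξ)
    (hξint : Integrable ξ P) (hξmean : (∫ ω, ξ ω ∂P) = 0)
    (hξ2int : Integrable (fun ω => ‖ξ ω‖ ^ 2) P)
    (hξvar : (∫ ω, ‖ξ ω‖ ^ 2 ∂P) = σ ^ 2)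
    (hindep : ∀ (s : Finset (Fin n)) (A : Set (EuclideanSpace ℝ (Fin d))),
      MeasurableSet A →
        P ({ω | S ω = s} ∩ ξ ⁻¹' A) = P {ω | S ω = s} * P (ξ ⁻¹' A))
    -- one noisy SGD step from θ₀:
    (θ₀ : EuclideanSpace ℝ (Fin d))
    (θ1 : Ωs → EuclideanSpace ℝ (Fin d))
    (hθ1 : ∀ ω, θ1 ω = θ₀ - (η / (b : ℝ)) • ∑ i ∈ S ω, g θ₀ (x i) + η • ξ ω) :
    (∫ ω, ‖θ1 ω - θstar‖ ^ 2 ∂P)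
      ≤ η ^ 2 * σ ^ 2 + (2 + 4 * η ^ 2 * K1 ^ 2) * ‖θ₀ - θstar‖ ^ 2
        + 4 * η ^ 2 *
          (Finset.univ.sup' (Finset.univ_nonempty_iff.mpr ⟨⟨0, hn⟩⟩)
            (fun i => ‖g θstar (x i)‖)) ^ 2 := by
  have hbound (i : Fin n) : ‖g θ₀ (x i)‖ ≤ K1 * ‖θ₀ - θstar‖ +
      Finset.univ.sup' (Finset.univ_nonempty_iff.mpr ⟨⟨0, hn⟩⟩) (fun i => ‖g θstar (x i)‖) :=
    (norm_le_norm_sub_add _ (g θstar (x i))).trans (add_le_add (hLip _ _ i)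
      (Finset.le_sup' (fun i => ‖g θstar (x i)‖) (Finset.mem_univ i)))
  have hstep (ω : Ωs) : θ1 ω - θstar =
      (θ₀ - θstar - (η / (b : ℝ)) • ∑ i ∈ S ω, g θ₀ (x i)) + η • ξ ω := by
    rw [hθ1]
    abel
  simp_rw [hstep]
  refine (integral_norm_add_smul_sq_le hSmeas hξmeas hξint hξmean hξ2int hindep
    (fun s => θ₀ - θstar - (η / (b : ℝ)) • ∑ i ∈ s, g θ₀ (x i)) η fun ω =>
      norm_sub_smul_sum_sq_le (by lia) (hScard ω) _ hη.le fun i _ => hbound i).trans_eq ?_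
  rw [hξvar]
  ring
end
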